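/- arXiv:1103.0341 — 2 statements merged into one kernel-verified Lean document; each statement's English description precedes it below -/
import Mathlib

section
/- For every t > 0, the random variables V_n(t) = ∑_{j=1}^{⌊nt⌋} (B(j/n) − B((j−1)/n))³ converge in distribution, as n → ∞, to a centered Gaussian random variable with variance κ² t. -/
open MeasureTheory ProbabilityTheory Filter Topology

noncomputable section

/-- `B` is a fractional Brownian motion with Hurst parameter `1/6`: a centered Gaussian
process with continuous sample paths and covariance
`E[B s * B t] = (t^(1/3) + s^(1/3) - |t - s|^(1/3)) / 2` for `s, t ≥ 0`. -/
def IsFBM16 {Ω : Type*} [MeasureSpace Ω] (B : ℝ → Ω → ℝ) : Prop :=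
  (∀ t : ℝ, Measurable (B t)) ∧
  (∀ ω : Ω, Continuous fun t : ℝ => B t ω) ∧
  (∀ (m : ℕ) (t : Fin m → ℝ) (c : Fin m → ℝ), (∀ i, 0 ≤ t i) →
    ∃ v : NNReal,
      Measure.map (fun ω => ∑ i, c i * B (t i) ω) (volume : Measure Ω) = gaussianReal 0 v) ∧
  (∀ s t : ℝ, 0 ≤ s → 0 ≤ t →
    ∫ ω, B s ω * B t ω =
      (t ^ ((1 : ℝ) / 3) + s ^ ((1 : ℝ) / 3) - |t - s| ^ ((1 : ℝ) / 3)) / 2)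

/-- The term of the series defining `κ²`. -/
def kappaTerm (r : ℤ) : ℝ :=
  (|(r : ℝ) + 1| ^ ((1 : ℝ) / 3) + |(r : ℝ) - 1| ^ ((1 : ℝ) / 3)
    - 2 * |(r : ℝ)| ^ ((1 : ℝ) / 3)) ^ 3

/-- The derivative of the standard Gaussian density `p` is `-x * p x`. -/
lemma hasDerivAt_gaussianPDFReal_std (x : ℝ) :
    HasDerivAt (gaussianPDFReal 0 1) (-(x * gaussianPDFReal 0 1 x)) x := by
  have h : gaussianPDFReal 0 1 =
      fun x => (√(2 * Real.pi * (1 : NNReal)))⁻¹ *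
        Real.exp (-(x - 0) ^ 2 / (2 * (1 : NNReal))) := by
    ext; rfl
  rw [h]
  have h1 : HasDerivAt (fun x : ℝ => -(x - 0) ^ 2 / (2 * ((1 : NNReal) : ℝ))) (-x) x := by
    have := ((((hasDerivAt_id x).sub_const 0).pow 2).neg).div_const (2 * ((1 : NNReal) : ℝ))
    refine this.congr_deriv ?_
    simp
    ring
  refine (h1.exp.const_mul _).congr_deriv ?_
  ring

lemma integrable_gaussianReal_iff_std {E : Type*} [NormedAddCommGroup E] [NormedSpace ℝ E]
    (u : ℝ → E) :
    Integrable u (gaussianReal 0 1) ↔ Integrable (fun x => gaussianPDFReal 0 1 x • u x) := by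
  rw [gaussianReal_of_var_ne_zero 0 one_ne_zero]
  rw [integrable_withDensity_iff_integrable_smul₀' (by fun_prop) (by simp [gaussianPDF])]
  simp [toReal_gaussianPDF]

/-- **Stein's lemma** for the standard Gaussian law. -/
lemma integral_id_smul_gaussianReal_eq {E : Type*} [NormedAddCommGroup E] [NormedSpace ℝ E]
    {u u' : ℝ → E} (hu : ∀ x, HasDerivAt u (u' x) x)
    (h0 : Integrable u (gaussianReal 0 1))
    (h1 : Integrable (fun x => x • u x) (gaussianReal 0 1))
    (h2 : Integrable u' (gaussianReal 0 1)) :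
    ∫ x, x • u x ∂gaussianReal 0 1 = ∫ x, u' x ∂gaussianReal 0 1 := by
  rw [integrable_gaussianReal_iff_std] at h0 h1 h2
  have key := integral_eq_zero_of_hasDerivAt_of_integrable
    (fun x => (hasDerivAt_gaussianPDFReal_std x).smul (hu x)) (f := fun x => _)
    (by
      refine (h2.sub h1).congr (ae_of_all _ fun x => ?_)
      simp only [Pi.sub_apply, smul_smul, neg_smul]
      rw [mul_comm x, ← sub_eq_add_neg]) h0
  rw [integral_gaussianReal_eq_integral_smul one_ne_zero,
    integral_gaussianReal_eq_integral_smul one_ne_zero, eq_comm, ← sub_eq_zero,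
    ← integral_sub h2 h1, ← key]
  congr with x
  simp only [smul_smul, neg_smul]
  rw [mul_comm x, ← sub_eq_add_neg]

/-- `μ` is a centered Gaussian law on `ℝ^ι` with covariance `c`, normalized to unit variances. -/
structure IsUnitGaussian {ι : Type*} [Fintype ι] (μ : Measure (ι → ℝ)) (c : ι → ι → ℝ) : Prop where
  isGaussian : IsGaussian μ
  integral_eval : ∀ k, ∫ x, x k ∂μ = 0
  integral_mul : ∀ j k, ∫ x, x j * x k ∂μ = c j k
  diag : ∀ j, c j j = 1

namespace IsUnitGaussian

variable {ι : Type*} [Fintype ι] {μ : Measure (ι → ℝ)} {c : ι → ι → ℝ}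
  {E : Type*} [NormedAddCommGroup E] [NormedSpace ℝ E]

lemma memLp_eval (h : IsUnitGaussian μ c) (k : ι) {p : ENNReal} (hp : p ≠ ⊤) :
    MemLp (fun x : ι → ℝ => x k) p μ := by
  have := h.isGaussian
  exact IsGaussian.memLp_dual μ (ContinuousLinearMap.proj k) p hp

lemma symm (h : IsUnitGaussian μ c) (j k : ι) : c j k = c k j := by
  rw [← h.integral_mul, ← h.integral_mul]
  simp_rw [mul_comm]

lemma covariance_eval (h : IsUnitGaussian μ c) (j k : ι) :
    cov[fun x : ι → ℝ => x j, fun x => x k; μ] = c j k := by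
  have := h.isGaussian
  rw [covariance_eq_sub (h.memLp_eval j (by simp)) (h.memLp_eval k (by simp)),
    h.integral_eval, h.integral_eval]
  simpa using h.integral_mul j k

lemma map_eval (h : IsUnitGaussian μ c) (j : ι) :
    μ.map (fun x : ι → ℝ => x j) = gaussianReal 0 1 := by
  have := h.isGaussian
  have h1 := IsGaussian.map_eq_gaussianReal (μ := μ) (ContinuousLinearMap.proj (R := ℝ) j)
  have h2 : Var[(ContinuousLinearMap.proj (R := ℝ) j : (ι → ℝ) →L[ℝ] ℝ); μ] = 1 := by
    rw [← covariance_self (by fun_prop), ← h.diag j]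
    exact h.covariance_eval j j
  rw [h2] at h1
  have h3 : ∫ x, (ContinuousLinearMap.proj (R := ℝ) j : (ι → ℝ) →L[ℝ] ℝ) x ∂μ = 0 :=
    h.integral_eval j
  rw [h3, Real.toNNReal_one] at h1
  exact h1

/-- The coordinate `x j` is independent of the residual `x - x j • c j`. -/
lemma map_prod_residual (h : IsUnitGaussian μ c) (j : ι) :
    μ.map (fun x => (x j, x - x j • c j)) =
      (gaussianReal 0 1).prod (μ.map fun x => x - x j • c j) := by
  have := h.isGaussian
  have hG : HasGaussianLaw (id : (ι → ℝ) → ι → ℝ) μ := ⟨by simpa using this⟩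
  let P : (ι → ℝ) →L[ℝ] ℝ := ContinuousLinearMap.proj j
  let L : (ι → ℝ) →L[ℝ] (Unit → ℝ) × (ι → ℝ) :=
    (ContinuousLinearMap.pi fun _ => P).prod (ContinuousLinearMap.id ℝ (ι → ℝ) - P.smulRight (c j))
  have hL := hG.map_fun L
  have hind : IndepFun (fun (x : ι → ℝ) (_ : Unit) => x j)
      (fun (x : ι → ℝ) (k : ι) => x k - x j * c j k) μ := by
    refine HasGaussianLaw.indepFun_of_covariance_eval (X := fun _ (x : ι → ℝ) => x j)
      (Y := fun k (x : ι → ℝ) => x k - x j * c j k) ?_ ?_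
    · exact hL
    · intro _ k
      have e : (fun x : ι → ℝ => x k - x j * c j k) =
        (fun x : ι → ℝ => x k) - fun x => x j * c j k := rfl
      rw [e, covariance_sub_right (h.memLp_eval j (by simp)) (h.memLp_eval k (by simp))
        ((h.memLp_eval j (by simp)).mul_const _), covariance_mul_const_right, h.covariance_eval,
        h.covariance_eval, h.diag]
      ring
  have hind2 := hind.comp (φ := fun f : Unit → ℝ => f ()) (ψ := id)
    (measurable_pi_apply (X := fun _ => ℝ) ()) measurable_id
  have := (indepFun_iff_map_prod_eq_prod_map_map
    (measurable_pi_apply j).aemeasurable (by fun_prop)).1 hind2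
  rw [← h.map_eval j]
  exact this

/-- **Gaussian integration by parts**: the derivative is taken in the direction `c j`. -/
lemma integral_eval_smul_eq (h : IsUnitGaussian μ c) (j : ι) {g g' : (ι → ℝ) → E}
    (hg : Continuous g) (hg' : Continuous g')
    (hd : ∀ x, HasDerivAt (fun s : ℝ => g (x + s • c j)) (g' x) 0)
    (i0 : Integrable g μ) (i1 : Integrable (fun x => x j • g x) μ) (i2 : Integrable g' μ) :
    ∫ x, x j • g x ∂μ = ∫ x, g' x ∂μ := by
  have := h.isGaussian
  set T : (ι → ℝ) → ℝ × (ι → ℝ) := fun x => (x j, x - x j • c j) with hT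
  have mT : Measurable T := by fun_prop
  set ν := μ.map fun x => x - x j • c j with hν
  have hmap : μ.map T = (gaussianReal 0 1).prod ν := h.map_prod_residual j
  have hprob : IsProbabilityMeasure ν := Measure.isProbabilityMeasure_map (by fun_prop)
  have tr : ∀ f : (ι → ℝ) → E, Continuous f → Integrable f μ →
      Integrable (fun p : ℝ × (ι → ℝ) => f (p.2 + p.1 • c j)) ((gaussianReal 0 1).prod ν) := by
    intro f hf hi
    rw [← hmap, integrable_map_measure (by fun_prop) mT.aemeasurable]
    simpa [Function.comp_def, hT] using hi
  have ti : ∀ f : (ι → ℝ) → E, Continuous f → Integrable f μ →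
      ∫ x, f x ∂μ = ∫ y, ∫ s, f (y + s • c j) ∂gaussianReal 0 1 ∂ν := by
    intro f hf hi
    rw [← integral_prod_symm _ (tr f hf hi), ← hmap, integral_map mT.aemeasurable (by fun_prop)]
    simp [hT]
  have tr' : Integrable (fun p : ℝ × (ι → ℝ) => p.1 • g (p.2 + p.1 • c j))
      ((gaussianReal 0 1).prod ν) := by
    rw [← hmap, integrable_map_measure (by fun_prop) mT.aemeasurable]
    simpa [Function.comp_def, hT] using i1
  have ti' : ∫ x, x j • g x ∂μ = ∫ y, ∫ s, s • g (y + s • c j) ∂gaussianReal 0 1 ∂ν := by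
    rw [← integral_prod_symm _ tr', ← hmap, integral_map mT.aemeasurable (by fun_prop)]
    simp [hT]
  rw [ti', ti g' hg' i2]
  refine integral_congr_ae ?_
  filter_upwards [(tr g hg i0).prod_left_ae, (tr g' hg' i2).prod_left_ae, tr'.prod_left_ae]
    with y h0 h2 h1
  refine integral_id_smul_gaussianReal_eq (fun s => ?_) h0 h1 h2
  have hs := hd (y + s • c j)
  rw [← sub_self s] at hs
  refine (hs.comp_sub_const s s).congr_of_eventuallyEq (Eventually.of_forall fun r => ?_)
  simp only [add_assoc, ← add_smul]
  congr 3
  ring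

end IsUnitGaussian

/-- All moments of `f` under `μ` are finite. -/
@[fun_prop]
def HasMoments {α E : Type*} [MeasurableSpace α] [NormedAddCommGroup E] (f : α → E)
    (μ : Measure α) : Prop :=
  ∀ p : ENNReal, p ≠ ⊤ → MemLp f p μ

namespace HasMoments

variable {α E : Type*} [MeasurableSpace α] [NormedAddCommGroup E] [NormedSpace ℝ E]
  {μ : Measure α}

omit [NormedSpace ℝ E] in
lemma integrable {f : α → E} (hf : HasMoments f μ) : Integrable f μ :=
  memLp_one_iff_integrable.1 (hf 1 (by simp))

omit [NormedSpace ℝ E] in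
@[fun_prop]
lemma const [IsFiniteMeasure μ] (a : E) : HasMoments (fun _ : α => a) μ :=
  fun _ _ => memLp_const a

omit [NormedSpace ℝ E] in
@[fun_prop]
lemma add {f g : α → E} (hf : HasMoments f μ) (hg : HasMoments g μ) :
    HasMoments (fun x => f x + g x) μ :=
  fun p hp => (hf p hp).add (hg p hp)

omit [NormedSpace ℝ E] in
@[fun_prop]
lemma sub {f g : α → E} (hf : HasMoments f μ) (hg : HasMoments g μ) :
    HasMoments (fun x => f x - g x) μ :=
  fun p hp => (hf p hp).sub (hg p hp)

@[fun_prop]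
lemma smul {f : α → ℝ} {g : α → E} (hf : HasMoments f μ) (hg : HasMoments g μ) :
    HasMoments (fun x => f x • g x) μ := by
  intro p hp
  have h2 : (2 : ENNReal) * p ≠ ⊤ := ENNReal.mul_ne_top (by simp) hp
  have : ENNReal.HolderTriple (2 * p) (2 * p) p := by
    constructor
    rw [ENNReal.mul_inv (by simp) (by simp), ← add_mul, ENNReal.inv_two_add_inv_two, one_mul]
  exact (hg _ h2).smul (hf _ h2)

@[fun_prop]
lemma mul {f g : α → ℝ} (hf : HasMoments f μ) (hg : HasMoments g μ) :
    HasMoments (fun x => f x * g x) μ :=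
  hf.smul hg

@[fun_prop]
lemma pow [IsFiniteMeasure μ] {f : α → ℝ} (hf : HasMoments f μ) (n : ℕ) :
    HasMoments (fun x => f x ^ n) μ := by
  induction n with
  | zero => simpa using const (1 : ℝ)
  | succ n ih => simpa only [pow_succ] using ih.mul hf

omit [NormedSpace ℝ E] in
@[fun_prop]
lemma sum {κ : Type*} (s : Finset κ) {f : κ → α → E} (hf : ∀ k, HasMoments (f k) μ) :
    HasMoments (fun x => ∑ k ∈ s, f k x) μ :=
  fun p hp => memLp_finsetSum s fun k _ => hf k p hp

@[fun_prop]
lemma eval {ι : Type*} [Fintype ι] {μ : Measure (ι → ℝ)} [IsGaussian μ] (k : ι) :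
    HasMoments (fun x : ι → ℝ => x k) μ :=
  fun p hp => IsGaussian.memLp_dual μ (ContinuousLinearMap.proj k) p hp

end HasMoments

namespace IsUnitGaussian

variable {ι : Type*} [Fintype ι] {μ : Measure (ι → ℝ)} {c : ι → ι → ℝ}
  {E : Type*} [NormedAddCommGroup E] [NormedSpace ℝ E]

omit [Fintype ι] in
lemma hasDerivAt_eval (c : ι → ι → ℝ) (j k : ι) (x : ι → ℝ) :
    HasDerivAt (fun s : ℝ => (x + s • c j) k) (c j k) 0 := by
  simpa using ((hasDerivAt_id (0 : ℝ)).mul_const (c j k)).const_add (x k)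

omit [Fintype ι] in
lemma hasDerivAt_eval_sq (c : ι → ι → ℝ) (j k : ι) (x : ι → ℝ) :
    HasDerivAt (fun s : ℝ => (x + s • c j) k ^ 2 - 1) (2 * c j k * x k) 0 := by
  refine (((hasDerivAt_eval c j k x).pow 2).sub_const 1).congr_deriv ?_
  simp
  ring

omit [Fintype ι] in
lemma hasDerivAt_eval_cube (c : ι → ι → ℝ) (j k : ι) (x : ι → ℝ) :
    HasDerivAt (fun s : ℝ => (x + s • c j) k ^ 3 - 3 * (x + s • c j) k)
      (3 * (c j k * (x k ^ 2 - 1))) 0 := by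
  refine (((hasDerivAt_eval c j k x).pow 3).sub
    ((hasDerivAt_eval c j k x).const_mul 3)).congr_deriv ?_
  simp
  ring

/-- Integration by parts against the second Hermite polynomial. -/
lemma integral_hermite_two_smul (h : IsUnitGaussian μ c) (j : ι) {g g' : (ι → ℝ) → E}
    (hg : Continuous g) (hg' : Continuous g')
    (hd : ∀ x, HasDerivAt (fun s : ℝ => g (x + s • c j)) (g' x) 0)
    (mg : HasMoments g μ) (mg' : HasMoments g' μ) :
    ∫ x, (x j ^ 2 - 1) • g x ∂μ = ∫ x, x j • g' x ∂μ := by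
  have := h.isGaussian
  have key := h.integral_eval_smul_eq j (g := fun x => x j • g x)
    (g' := fun x => x j • g' x + g x) (by fun_prop) (by fun_prop) (fun x => by
      refine ((hasDerivAt_eval c j j x).smul (hd x)).congr_deriv ?_
      simp [h.diag]) (HasMoments.integrable (by fun_prop)) (HasMoments.integrable (by fun_prop))
      (HasMoments.integrable (by fun_prop))
  rw [integral_add (HasMoments.integrable (by fun_prop)) (HasMoments.integrable (by fun_prop)),
    ← sub_eq_iff_eq_add, ← integral_sub (HasMoments.integrable (by fun_prop))
    (HasMoments.integrable (by fun_prop))] at key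
  rw [← key]
  congr with x
  rw [smul_smul, sub_smul, one_smul, pow_two]

/-- Integration by parts against the third Hermite polynomial. -/
lemma integral_hermite_three_smul (h : IsUnitGaussian μ c) (j : ι) {g g' : (ι → ℝ) → E}
    (hg : Continuous g) (hg' : Continuous g')
    (hd : ∀ x, HasDerivAt (fun s : ℝ => g (x + s • c j)) (g' x) 0)
    (mg : HasMoments g μ) (mg' : HasMoments g' μ) :
    ∫ x, (x j ^ 3 - 3 * x j) • g x ∂μ = ∫ x, (x j ^ 2 - 1) • g' x ∂μ := by
  have := h.isGaussian
  have key := h.integral_eval_smul_eq j (g := fun x => (x j ^ 2 - 1) • g x)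
    (g' := fun x => (x j ^ 2 - 1) • g' x + (2 * x j) • g x) (by fun_prop) (by fun_prop) (fun x => by
      refine ((hasDerivAt_eval_sq c j j x).smul (hd x)).congr_deriv ?_
      simp [h.diag]) (HasMoments.integrable (by fun_prop)) (HasMoments.integrable (by fun_prop))
      (HasMoments.integrable (by fun_prop))
  rw [integral_add (HasMoments.integrable (by fun_prop)) (HasMoments.integrable (by fun_prop)),
    ← sub_eq_iff_eq_add, ← integral_sub (HasMoments.integrable (by fun_prop))
    (HasMoments.integrable (by fun_prop))] at key
  rw [← key]
  congr with x
  rw [smul_smul, ← sub_smul]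
  ring_nf

/-- The covariance of two squared coordinates. -/
lemma integral_hermite_two_mul (h : IsUnitGaussian μ c) (l m : ι) :
    ∫ x, (x l ^ 2 - 1) * (x m ^ 2 - 1) ∂μ = 2 * c l m ^ 2 := by
  have := h.isGaussian
  have h1 := h.integral_hermite_two_smul l (g := fun x => x m ^ 2 - 1)
    (g' := fun x => 2 * c l m * x m) (by fun_prop) (by fun_prop)
    (fun x => hasDerivAt_eval_sq c l m x) (by fun_prop) (by fun_prop)
  simp only [smul_eq_mul] at h1
  rw [h1]
  have : ∀ x : ι → ℝ, x l * (2 * c l m * x m) = 2 * c l m * (x l * x m) := fun x => by ring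
  simp_rw [this]
  rw [integral_const_mul, h.integral_mul]
  ring

/-- Decoupling of a product of four squared coordinates. -/
lemma integral_hermite_two_mul_four (h : IsUnitGaussian μ c) (j k l m : ι) :
    ∫ x, (x j ^ 2 - 1) * (x k ^ 2 - 1) * ((x l ^ 2 - 1) * (x m ^ 2 - 1)) ∂μ =
      (2 * c j k ^ 2) * (2 * c l m ^ 2)
      + c j l * ∫ x, (4 * c j k * (x k * x l * (x m ^ 2 - 1))
          + 2 * (x j * (x k ^ 2 - 1) * x l * (x m ^ 2 - 1))) ∂μ
      + c j m * ∫ x, (4 * c j k * (x k * x m * (x l ^ 2 - 1))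
          + 2 * (x j * (x k ^ 2 - 1) * x m * (x l ^ 2 - 1))) ∂μ := by
  have := h.isGaussian
  have hdh : ∀ x, HasDerivAt (fun s : ℝ => ((x + s • c j) l ^ 2 - 1) * ((x + s • c j) m ^ 2 - 1))
      (2 * c j l * x l * (x m ^ 2 - 1) + (x l ^ 2 - 1) * (2 * c j m * x m)) 0 := fun x => by
    refine ((hasDerivAt_eval_sq c j l x).mul (hasDerivAt_eval_sq c j m x)).congr_deriv ?_
    simp
  have h1 := h.integral_hermite_two_smul j
    (g := fun x => (x k ^ 2 - 1) * ((x l ^ 2 - 1) * (x m ^ 2 - 1)))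
    (g' := fun x => 2 * c j k * x k * ((x l ^ 2 - 1) * (x m ^ 2 - 1)) + (x k ^ 2 - 1) *
      (2 * c j l * x l * (x m ^ 2 - 1) + (x l ^ 2 - 1) * (2 * c j m * x m)))
    (by fun_prop) (by fun_prop) (fun x => by
      refine ((hasDerivAt_eval_sq c j k x).mul (hdh x)).congr_deriv ?_
      simp) (by fun_prop) (by fun_prop)
  have h2 := h.integral_eval_smul_eq j
    (g := fun x => x k * ((x l ^ 2 - 1) * (x m ^ 2 - 1)))
    (g' := fun x => c j k * ((x l ^ 2 - 1) * (x m ^ 2 - 1)) + x k *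
      (2 * c j l * x l * (x m ^ 2 - 1) + (x l ^ 2 - 1) * (2 * c j m * x m)))
    (by fun_prop) (by fun_prop) (fun x => by
      refine ((hasDerivAt_eval c j k x).mul (hdh x)).congr_deriv ?_
      simp) (HasMoments.integrable (by fun_prop)) (HasMoments.integrable (by fun_prop))
      (HasMoments.integrable (by fun_prop))
  have h3 := h.integral_hermite_two_mul l m
  simp only [smul_eq_mul] at h1 h2
  rw [integral_add (HasMoments.integrable (by fun_prop)) (HasMoments.integrable (by fun_prop)),
    integral_const_mul, h3] at h2
  have e1 : ∀ x : ι → ℝ, (x j ^ 2 - 1) * (x k ^ 2 - 1) * ((x l ^ 2 - 1) * (x m ^ 2 - 1)) =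
      (x j ^ 2 - 1) * ((x k ^ 2 - 1) * ((x l ^ 2 - 1) * (x m ^ 2 - 1))) := fun x => by ring
  have e2 : ∀ x : ι → ℝ, x j * (2 * c j k * x k * ((x l ^ 2 - 1) * (x m ^ 2 - 1)) +
      (x k ^ 2 - 1) * (2 * c j l * x l * (x m ^ 2 - 1) + (x l ^ 2 - 1) * (2 * c j m * x m))) =
      2 * c j k * (x j * (x k * ((x l ^ 2 - 1) * (x m ^ 2 - 1)))) +
      (x j * (x k ^ 2 - 1) * (2 * c j l * x l * (x m ^ 2 - 1) +
        (x l ^ 2 - 1) * (2 * c j m * x m))) := fun x => by ring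
  simp_rw [e1]
  rw [h1]
  simp_rw [e2]
  rw [integral_add (HasMoments.integrable (by fun_prop)) (HasMoments.integrable (by fun_prop)),
    integral_const_mul, h2, mul_add, add_assoc, ← integral_const_mul, ← integral_const_mul,
    ← integral_const_mul, add_assoc,
    ← integral_add (HasMoments.integrable (by fun_prop)) (HasMoments.integrable (by fun_prop)),
    ← integral_add (HasMoments.integrable (by fun_prop)) (HasMoments.integrable (by fun_prop))]
  congr 1
  · ring
  · congr with x
    ring

lemma integral_comp_eval (h : IsUnitGaussian μ c) (j : ι) {f : ℝ → ℝ} (hf : Continuous f) :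
    ∫ x, f (x j) ∂μ = ∫ y, f y ∂gaussianReal 0 1 := by
  rw [← h.map_eval j, integral_map (measurable_pi_apply j).aemeasurable (by fun_prop)]

lemma abs_le_one (h : IsUnitGaussian μ c) (j k : ι) : |c j k| ≤ 1 := by
  have := h.isGaussian
  have hjj := h.integral_mul j j
  have hkk := h.integral_mul k k
  rw [h.diag] at hjj hkk
  have hp : 0 ≤ ∫ x, (x j * x j + 2 * (x j * x k) + x k * x k) ∂μ :=
    integral_nonneg fun x => by
      change 0 ≤ x j * x j + 2 * (x j * x k) + x k * x k
      nlinarith [sq_nonneg (x j + x k)]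
  have hm : 0 ≤ ∫ x, (x j * x j - 2 * (x j * x k) + x k * x k) ∂μ :=
    integral_nonneg fun x => by
      change 0 ≤ x j * x j - 2 * (x j * x k) + x k * x k
      nlinarith [sq_nonneg (x j - x k)]
  rw [integral_add (HasMoments.integrable (by fun_prop)) (HasMoments.integrable (by fun_prop)),
    integral_add (HasMoments.integrable (by fun_prop)) (HasMoments.integrable (by fun_prop)),
    integral_const_mul, h.integral_mul j k, hjj, hkk] at hp
  rw [integral_add (HasMoments.integrable (by fun_prop)) (HasMoments.integrable (by fun_prop)),
    integral_sub (HasMoments.integrable (by fun_prop)) (HasMoments.integrable (by fun_prop)),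
    integral_const_mul, h.integral_mul j k, hjj, hkk] at hm
  rw [abs_le]
  constructor <;> linarith

end IsUnitGaussian

/-- A fixed moment of the standard Gaussian law dominating mixed Hermite moments. -/
def hermiteMoment : ℝ := ∫ y, (1 + y ^ 4 + (y ^ 2 - 1) ^ 4) ∂gaussianReal 0 1

lemma hermiteMoment_nonneg : 0 ≤ hermiteMoment :=
  integral_nonneg fun y => by positivity

lemma abs_mul_four_le (a b c d : ℝ) : |a * b * c * d| ≤ a ^ 4 + b ^ 4 + c ^ 4 + d ^ 4 := by
  rw [abs_le]
  constructor <;>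
  nlinarith [sq_nonneg (a * b + c * d), sq_nonneg (a * b - c * d), sq_nonneg (a ^ 2 - b ^ 2),
    sq_nonneg (c ^ 2 - d ^ 2), sq_nonneg (a ^ 2), sq_nonneg (b ^ 2), sq_nonneg (c ^ 2),
    sq_nonneg (d ^ 2)]

namespace IsUnitGaussian

variable {ι : Type*} [Fintype ι] {μ : Measure (ι → ℝ)} {c : ι → ι → ℝ}

lemma abs_integral_mixed_le (h : IsUnitGaussian μ c) (j k l m : ι) {b : ℝ} (hb : |b| ≤ 1) :
    |∫ x, (4 * b * (x k * x l * (x m ^ 2 - 1))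
      + 2 * (x j * (x k ^ 2 - 1) * x l * (x m ^ 2 - 1))) ∂μ| ≤ 20 * hermiteMoment := by
  have := h.isGaussian
  set w : ℝ → ℝ := fun y => 1 + y ^ 4 + (y ^ 2 - 1) ^ 4 with hw
  have hwi : ∀ i, ∫ x, w (x i) ∂μ = hermiteMoment := fun i =>
    h.integral_comp_eval i (by fun_prop)
  refine (abs_integral_le_integral_abs).trans ?_
  have hbd : ∀ x : ι → ℝ, |4 * b * (x k * x l * (x m ^ 2 - 1))
      + 2 * (x j * (x k ^ 2 - 1) * x l * (x m ^ 2 - 1))| ≤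
      6 * w (x k) + 6 * w (x l) + 6 * w (x m) + 2 * w (x j) := fun x => by
    have h1 := abs_mul_four_le (x k) (x l) (x m ^ 2 - 1) 1
    have h2 := abs_mul_four_le (x j) (x k ^ 2 - 1) (x l) (x m ^ 2 - 1)
    have h3 : |4 * b * (x k * x l * (x m ^ 2 - 1))| ≤ 4 * |x k * x l * (x m ^ 2 - 1) * 1| := by
      rw [abs_mul, abs_mul, mul_one, abs_of_pos (by norm_num : (0 : ℝ) < 4)]
      have := abs_nonneg (x k * x l * (x m ^ 2 - 1))
      nlinarith
    refine (abs_add_le _ _).trans ?_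
    rw [abs_mul 2, abs_of_pos (by norm_num : (0 : ℝ) < 2)]
    have p1 : ∀ y : ℝ, 0 ≤ y ^ 4 := fun y => by positivity
    simp only [hw]
    linarith [p1 (x j), p1 (x k), p1 (x l), p1 (x m), p1 (x j ^ 2 - 1), p1 (x k ^ 2 - 1),
      p1 (x l ^ 2 - 1), p1 (x m ^ 2 - 1)]
  have hi : ∀ (a : ℝ) (i : ι), Integrable (fun x : ι → ℝ => a * w (x i)) μ := fun a i =>
    HasMoments.integrable (by simp only [hw]; fun_prop)
  have h3 := ((hi 6 k).add (hi 6 l)).add (hi 6 m)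
  refine (integral_mono (HasMoments.integrable (by fun_prop)).abs (h3.add (hi 2 j)) hbd).trans ?_
  rw [integral_add' h3 (hi 2 j), integral_add' ((hi 6 k).add (hi 6 l)) (hi 6 m),
    integral_add' (hi 6 k) (hi 6 l)]
  simp only [integral_const_mul, hwi]
  linarith

lemma abs_covariance_hermite_two_le (h : IsUnitGaussian μ c) (j k l m : ι) :
    |∫ x, (x j ^ 2 - 1) * (x k ^ 2 - 1) * ((x l ^ 2 - 1) * (x m ^ 2 - 1)) ∂μ
      - (2 * c j k ^ 2) * (2 * c l m ^ 2)| ≤ 20 * hermiteMoment * (|c j l| + |c j m|) := by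
  rw [h.integral_hermite_two_mul_four, add_assoc, add_sub_cancel_left]
  refine (abs_add_le _ _).trans ?_
  rw [abs_mul, abs_mul, mul_add, mul_comm |c j l|, mul_comm |c j m|]
  gcongr
  · exact h.abs_integral_mixed_le j k l m (h.abs_le_one j k)
  · exact h.abs_integral_mixed_le j k m l (h.abs_le_one j k)

end IsUnitGaussian

/-- The normalized cubic Hermite functional. -/
def cubicHermite {ι : Type*} [Fintype ι] (a : ℝ) (x : ι → ℝ) : ℝ :=
  a * ∑ k, (x k ^ 3 - 3 * x k)

/-- The Stein kernel of `cubicHermite`. -/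
def steinKernel {ι : Type*} [Fintype ι] (a : ℝ) (c : ι → ι → ℝ) (x : ι → ℝ) : ℝ :=
  3 * a ^ 2 * ∑ p : ι × ι, c p.1 p.2 * ((x p.1 ^ 2 - 1) * (x p.2 ^ 2 - 1))

@[fun_prop]
lemma continuous_cubicHermite {ι : Type*} [Fintype ι] (a : ℝ) :
    Continuous (cubicHermite (ι := ι) a) := by
  unfold cubicHermite
  fun_prop

@[fun_prop]
lemma continuous_steinKernel {ι : Type*} [Fintype ι] (a : ℝ) (c : ι → ι → ℝ) :
    Continuous (steinKernel a c) := by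
  unfold steinKernel
  fun_prop

@[fun_prop]
lemma hasMoments_cubicHermite {ι : Type*} [Fintype ι] (a : ℝ) {μ : Measure (ι → ℝ)}
    [IsGaussian μ] : HasMoments (cubicHermite (ι := ι) a) μ := by
  unfold cubicHermite
  fun_prop

@[fun_prop]
lemma hasMoments_steinKernel {ι : Type*} [Fintype ι] (a : ℝ) (c : ι → ι → ℝ)
    {μ : Measure (ι → ℝ)} [IsGaussian μ] : HasMoments (steinKernel a c) μ := by
  unfold steinKernel
  fun_prop

lemma integral_abs_le_sqrt {α : Type*} [MeasurableSpace α] {μ : Measure α}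
    [IsProbabilityMeasure μ] {f : α → ℝ} (hf : MemLp f 2 μ) :
    ∫ x, |f x| ∂μ ≤ √(∫ x, f x ^ 2 ∂μ) := by
  refine Real.le_sqrt_of_sq_le ?_
  have h := variance_nonneg |f| μ
  rw [variance_eq_sub hf.abs] at h
  simpa using h

lemma sum_abs_mul_abs_le {ι : Type*} [Fintype ι] {c : ι → ι → ℝ} {S : ℝ}
    (hsymm : ∀ j k, c j k = c k j) (hS : ∀ j, ∑ k, |c j k| ≤ S) (hS0 : 0 ≤ S) :
    ∑ p : ι × ι, ∑ q : ι × ι,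
      |c p.1 p.2| * |c q.1 q.2| * (|c p.1 q.1| + |c p.1 q.2|) ≤ 2 * Fintype.card ι * S ^ 3 := by
  have h1 : ∀ j, ∑ q : ι × ι, |c q.1 q.2| * |c j q.1| ≤ S ^ 2 := fun j => by
    calc ∑ q : ι × ι, |c q.1 q.2| * |c j q.1| = ∑ l, |c j l| * ∑ m, |c l m| := by
          rw [Fintype.sum_prod_type]
          simp_rw [Finset.mul_sum, mul_comm]
      _ ≤ ∑ l, |c j l| * S := by gcongr with l; exact hS l
      _ ≤ S ^ 2 := by
          rw [← Finset.sum_mul, pow_two]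
          gcongr
          exact hS j
  have h2 : ∀ j, ∑ q : ι × ι, |c q.1 q.2| * |c j q.2| ≤ S ^ 2 := fun j => by
    refine le_trans (le_of_eq ?_) (h1 j)
    rw [← (Equiv.prodComm ι ι).sum_comp]
    simp [hsymm]
  calc ∑ p : ι × ι, ∑ q : ι × ι, |c p.1 p.2| * |c q.1 q.2| * (|c p.1 q.1| + |c p.1 q.2|)
      = ∑ p : ι × ι, |c p.1 p.2| *
        (∑ q : ι × ι, |c q.1 q.2| * |c p.1 q.1| + ∑ q : ι × ι, |c q.1 q.2| * |c p.1 q.2|) := by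
        simp_rw [← Finset.sum_add_distrib, Finset.mul_sum, ← mul_add, mul_assoc]
    _ ≤ ∑ p : ι × ι, |c p.1 p.2| * (S ^ 2 + S ^ 2) := by
        gcongr with p
        · exact h1 p.1
        · exact h2 p.1
    _ = ∑ j, (∑ k, |c j k|) * (S ^ 2 + S ^ 2) := by
        rw [Fintype.sum_prod_type]
        simp_rw [Finset.sum_mul]
    _ ≤ ∑ j : ι, S * (S ^ 2 + S ^ 2) := by gcongr with j; exact hS j
    _ = 2 * Fintype.card ι * S ^ 3 := by
        simp only [Finset.sum_const, Finset.card_univ, nsmul_eq_mul]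
        ring

namespace IsUnitGaussian

variable {ι : Type*} [Fintype ι] {μ : Measure (ι → ℝ)} {c : ι → ι → ℝ}

lemma integral_steinKernel (h : IsUnitGaussian μ c) (a : ℝ) :
    ∫ x, steinKernel a c x ∂μ = 6 * a ^ 2 * ∑ j, ∑ k, c j k ^ 3 := by
  have := h.isGaussian
  unfold steinKernel
  rw [integral_const_mul, integral_finsetSum _ fun p _ => HasMoments.integrable (by fun_prop)]
  simp_rw [integral_const_mul, h.integral_hermite_two_mul]
  rw [Fintype.sum_prod_type]
  simp only [Finset.mul_sum]
  refine Finset.sum_congr rfl fun j _ => Finset.sum_congr rfl fun k _ => ?_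
  ring

lemma integral_steinKernel_sub_sq_le (h : IsUnitGaussian μ c) (a : ℝ) {S : ℝ}
    (hS : ∀ j, ∑ k, |c j k| ≤ S) (hS0 : 0 ≤ S) :
    ∫ x, (steinKernel a c x - ∫ y, steinKernel a c y ∂μ) ^ 2 ∂μ ≤
      360 * hermiteMoment * a ^ 4 * Fintype.card ι * S ^ 3 := by
  have := h.isGaussian
  have hmean : ∫ y, steinKernel a c y ∂μ =
      3 * a ^ 2 * ∑ p : ι × ι, c p.1 p.2 * (2 * c p.1 p.2 ^ 2) := by
    rw [h.integral_steinKernel, Fintype.sum_prod_type]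
    simp only [Finset.mul_sum]
    refine Finset.sum_congr rfl fun j _ => Finset.sum_congr rfl fun k _ => ?_
    ring
  have hexp : ∀ x : ι → ℝ, (steinKernel a c x - ∫ y, steinKernel a c y ∂μ) ^ 2 =
      9 * a ^ 4 * ∑ p : ι × ι, ∑ q : ι × ι, c p.1 p.2 * c q.1 q.2 *
        (((x p.1 ^ 2 - 1) * (x p.2 ^ 2 - 1) - 2 * c p.1 p.2 ^ 2) *
          ((x q.1 ^ 2 - 1) * (x q.2 ^ 2 - 1) - 2 * c q.1 q.2 ^ 2)) := fun x => by
    rw [hmean, steinKernel, ← mul_sub, ← Finset.sum_sub_distrib, mul_pow, pow_two (∑ _, _),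
      Finset.sum_mul_sum]
    congr 1
    · ring
    · refine Finset.sum_congr rfl fun p _ => Finset.sum_congr rfl fun q _ => ?_
      ring
  have hcov : ∀ p q : ι × ι, ∫ x, ((x p.1 ^ 2 - 1) * (x p.2 ^ 2 - 1) - 2 * c p.1 p.2 ^ 2) *
      ((x q.1 ^ 2 - 1) * (x q.2 ^ 2 - 1) - 2 * c q.1 q.2 ^ 2) ∂μ =
      ∫ x, (x p.1 ^ 2 - 1) * (x p.2 ^ 2 - 1) * ((x q.1 ^ 2 - 1) * (x q.2 ^ 2 - 1)) ∂μ
      - (2 * c p.1 p.2 ^ 2) * (2 * c q.1 q.2 ^ 2) := fun p q => by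
    simp_rw [sub_mul _ (2 * c p.1 p.2 ^ 2), mul_sub _ _ (2 * c q.1 q.2 ^ 2)]
    rw [integral_sub (HasMoments.integrable (by fun_prop)) (HasMoments.integrable (by fun_prop)),
      integral_sub (HasMoments.integrable (by fun_prop)) (HasMoments.integrable (by fun_prop)),
      integral_sub (HasMoments.integrable (by fun_prop)) (HasMoments.integrable (by fun_prop)),
      integral_mul_const, integral_const_mul, h.integral_hermite_two_mul,
      h.integral_hermite_two_mul]
    simp
  simp_rw [hexp]
  rw [integral_const_mul, integral_finsetSum _ fun p _ => HasMoments.integrable (by fun_prop)]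
  have hq : ∀ p : ι × ι, ∫ x, ∑ q : ι × ι, c p.1 p.2 * c q.1 q.2 *
        (((x p.1 ^ 2 - 1) * (x p.2 ^ 2 - 1) - 2 * c p.1 p.2 ^ 2) *
          ((x q.1 ^ 2 - 1) * (x q.2 ^ 2 - 1) - 2 * c q.1 q.2 ^ 2)) ∂μ = _ := fun p =>
    integral_finsetSum _ fun q _ => HasMoments.integrable (by fun_prop)
  simp_rw [hq, integral_const_mul, hcov]
  calc _ ≤ 9 * a ^ 4 * ∑ p : ι × ι, ∑ q : ι × ι, 20 * hermiteMoment *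
        (|c p.1 p.2| * |c q.1 q.2| * (|c p.1 q.1| + |c p.1 q.2|)) := by
        refine mul_le_mul_of_nonneg_left (Finset.sum_le_sum fun p _ =>
          Finset.sum_le_sum fun q _ => ?_) (by positivity)
        refine (le_abs_self _).trans ?_
        rw [abs_mul, abs_mul]
        have := h.abs_covariance_hermite_two_le p.1 p.2 q.1 q.2
        calc _ ≤ |c p.1 p.2| * |c q.1 q.2| *
              (20 * hermiteMoment * (|c p.1 q.1| + |c p.1 q.2|)) := by gcongr
          _ = _ := by ring
    _ = 180 * hermiteMoment * a ^ 4 * ∑ p : ι × ι, ∑ q : ι × ι,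
        (|c p.1 p.2| * |c q.1 q.2| * (|c p.1 q.1| + |c p.1 q.2|)) := by
        simp_rw [← Finset.mul_sum]
        ring
    _ ≤ 180 * hermiteMoment * a ^ 4 * (2 * Fintype.card ι * S ^ 3) := by
        have := hermiteMoment_nonneg
        gcongr
        exact sum_abs_mul_abs_le h.symm hS hS0
    _ = _ := by ring

open Complex in
/-- The Stein identity for `cubicHermite` tested against complex exponentials. -/
lemma integral_cubicHermite_mul_exp (h : IsUnitGaussian μ c) (a t : ℝ) :
    ∫ x, (cubicHermite a x : ℂ) * exp (t * cubicHermite a x * I) ∂μ =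
      t * I * ∫ x, (steinKernel a c x : ℂ) * exp (t * cubicHermite a x * I) ∂μ := by
  have := h.isGaussian
  set e : (ι → ℝ) → ℂ := fun x => exp (t * cubicHermite a x * I) with he
  have ce : Continuous e := by fun_prop
  have me : HasMoments e μ := fun p _ => by
    refine MemLp.of_bound ce.aestronglyMeasurable 1 (ae_of_all _ fun x => ?_)
    have : (t : ℂ) * cubicHermite a x * I = ((t * cubicHermite a x : ℝ) : ℂ) * I := by
      push_cast
      ring
    rw [he]
    simp only [this, norm_exp_ofReal_mul_I, le_refl]
  set D : ι → (ι → ℝ) → ℝ := fun j x => a * ∑ k, 3 * (c j k * (x k ^ 2 - 1)) with hD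
  have cD : ∀ j, Continuous (D j) := fun j => by fun_prop
  have mD : ∀ j, HasMoments (D j) μ := fun j => by
    simp only [hD]
    fun_prop
  have de : ∀ j x, HasDerivAt (fun s : ℝ => e (x + s • c j)) (D j x • (t * I * e x)) 0 := by
    intro j x
    have h1 : HasDerivAt (fun s : ℝ => cubicHermite a (x + s • c j)) (D j x) 0 :=
      (HasDerivAt.fun_sum fun k _ => hasDerivAt_eval_cube c j k x).const_mul a
    refine (((h1.ofReal_comp.const_mul (t : ℂ)).mul_const I).cexp).congr_deriv ?_
    simp only [zero_smul, add_zero, real_smul, he]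
    ring
  have key : ∀ j, ∫ x, (x j ^ 3 - 3 * x j) • e x ∂μ =
      ∫ x, (x j ^ 2 - 1) • D j x • (t * I * e x) ∂μ := fun j => by
    have := mD j
    have := cD j
    have mte : HasMoments (fun x => t * I * e x) μ := fun p hp => (me p hp).const_mul _
    exact h.integral_hermite_three_smul j ce (by fun_prop) (de j) me (by fun_prop)
  have lhs : ∀ x, (cubicHermite a x : ℂ) * e x = ∑ j, a * ((x j ^ 3 - 3 * x j) • e x) := by
    intro x
    simp only [cubicHermite, real_smul]
    push_cast
    rw [Finset.mul_sum, Finset.sum_mul]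
    simp_rw [mul_assoc]
  have rhs : ∀ x, (t * I) * ((steinKernel a c x : ℂ) * e x) =
      ∑ j, a * ((x j ^ 2 - 1) • D j x • (t * I * e x)) := by
    intro x
    simp only [steinKernel, hD, real_smul]
    rw [Fintype.sum_prod_type]
    push_cast
    simp_rw [Finset.mul_sum, Finset.sum_mul, Finset.mul_sum]
    refine Finset.sum_congr rfl fun j _ => Finset.sum_congr rfl fun k _ => ?_
    ring
  rw [← integral_const_mul]
  change ∫ x, (cubicHermite a x : ℂ) * e x ∂μ =
    ∫ x, (t * I) * ((steinKernel a c x : ℂ) * e x) ∂μ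
  rw [integral_congr_ae (ae_of_all _ lhs), integral_congr_ae (ae_of_all _ rhs)]
  have mte : HasMoments (fun x => t * I * e x) μ := fun p hp => (me p hp).const_mul _
  rw [integral_finsetSum _ fun j _ => Integrable.const_mul (HasMoments.integrable (by fun_prop)) _,
    integral_finsetSum _ fun j _ => Integrable.const_mul
      (HasMoments.integrable (by have := mD j; fun_prop)) _]
  refine Finset.sum_congr rfl fun j _ => ?_
  rw [integral_const_mul, integral_const_mul, key j]

end IsUnitGaussian

section CharFun

variable {α : Type*} [MeasurableSpace α] {μ : Measure α}

open Complex

lemma norm_exp_mul_mul_I (u x : ℝ) : ‖exp (u * x * I)‖ = 1 := by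
  rw [← ofReal_mul, norm_exp_ofReal_mul_I]

lemma aestronglyMeasurable_exp_mul_I {F : α → ℝ} (hF : AEStronglyMeasurable F μ) (u : ℝ) :
    AEStronglyMeasurable (fun x => exp (u * F x * I)) μ :=
  (by fun_prop : Continuous fun y : ℝ => exp (u * y * I)).comp_aestronglyMeasurable hF

lemma hasDerivAt_integral_exp_mul_I [IsFiniteMeasure μ] {F : α → ℝ} (hF : Integrable F μ)
    (u : ℝ) :
    HasDerivAt (fun u : ℝ => ∫ x, exp (u * F x * I) ∂μ)
      (I * ∫ x, (F x : ℂ) * exp (u * F x * I) ∂μ) u := by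
  rw [← integral_const_mul]
  refine (hasDerivAt_integral_of_dominated_loc_of_deriv_le (μ := μ) (𝕜 := ℝ)
    (F := fun (u : ℝ) x => exp (u * F x * I))
    (F' := fun (u : ℝ) x => I * ((F x : ℂ) * exp (u * F x * I))) (s := Set.univ)
    (bound := fun x => |F x|) univ_mem
    (.of_forall fun v => aestronglyMeasurable_exp_mul_I hF.1 v) ?_ ?_ ?_ hF.abs ?_).2
  · exact .of_bound (aestronglyMeasurable_exp_mul_I hF.1 u) 1
      (ae_of_all _ fun x => (norm_exp_mul_mul_I u (F x)).le)
  · exact ((continuous_ofReal.comp_aestronglyMeasurable hF.1).mul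
      (aestronglyMeasurable_exp_mul_I hF.1 u)).const_mul I
  · refine ae_of_all _ fun x v _ => ?_
    simp [norm_exp_mul_mul_I]
  · refine ae_of_all _ fun x v _ => ?_
    refine ((((hasDerivAt_id v).ofReal_comp.mul_const (F x : ℂ)).mul_const I).cexp).congr_deriv ?_
    simp
    ring

/-- A Stein kernel that is close to a constant forces the characteristic function to be close to
that of a Gaussian law. -/
lemma norm_integral_exp_sub_le [IsProbabilityMeasure μ] {F G : α → ℝ} (hF : Integrable F μ)
    (hG : Integrable G μ)
    (hFG : ∀ u : ℝ, ∫ x, (F x : ℂ) * exp (u * F x * I) ∂μ =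
      u * I * ∫ x, (G x : ℂ) * exp (u * F x * I) ∂μ)
    {s : ℝ} (hs : 0 ≤ s) (t : ℝ) :
    ‖∫ x, exp (t * F x * I) ∂μ - exp (-(t ^ 2 * s / 2 : ℝ))‖ ≤ t ^ 2 * ∫ x, |G x - s| ∂μ := by
  set E : ℝ → ℂ := fun u => exp ((u ^ 2 * s / 2 : ℝ)) with hE
  have dE : ∀ u, HasDerivAt E (u * s * E u) u := fun u => by
    refine ((((hasDerivAt_id u).pow 2).mul_const s).div_const 2).ofReal_comp.cexp.congr_deriv ?_
    simp [hE]
    ring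
  have nE : ∀ u, ‖E u‖ = Real.exp (u ^ 2 * s / 2) := fun u => by
    simp only [hE, ← ofReal_exp, norm_real, Real.norm_eq_abs, Real.abs_exp]
  have hint : ∀ u : ℝ, Integrable (fun x => exp (u * F x * I)) μ := fun u =>
    .of_bound (aestronglyMeasurable_exp_mul_I hF.1 u) 1
      (ae_of_all _ fun x => (norm_exp_mul_mul_I u (F x)).le)
  have hintG : ∀ u : ℝ, Integrable (fun x => (G x : ℂ) * exp (u * F x * I)) μ := fun u =>
    hG.ofReal.mul_bdd (aestronglyMeasurable_exp_mul_I hF.1 u)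
      (ae_of_all _ fun x => (norm_exp_mul_mul_I u (F x)).le)
  set ψ : ℝ → ℂ := fun u => (∫ x, exp (u * F x * I) ∂μ) * E u with hψ
  have dψ : ∀ u, HasDerivAt ψ (-(u * E u * ∫ x, ((G x - s : ℝ) : ℂ) * exp (u * F x * I) ∂μ)) u :=
    fun u => by
    refine ((hasDerivAt_integral_exp_mul_I hF u).mul (dE u)).congr_deriv ?_
    have : ∫ x, ((G x - s : ℝ) : ℂ) * exp (u * F x * I) ∂μ =
        ∫ x, (G x : ℂ) * exp (u * F x * I) ∂μ - s * ∫ x, exp (u * F x * I) ∂μ := by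
      rw [← integral_const_mul, ← integral_sub (hintG u) ((hint u).const_mul _)]
      congr with x
      push_cast
      ring
    rw [this, hFG]
    linear_combination (u * (∫ x, (G x : ℂ) * exp (u * F x * I) ∂μ) * E u) * I_sq
  have hδ : ∀ u : ℝ, ‖∫ x, ((G x - s : ℝ) : ℂ) * exp (u * F x * I) ∂μ‖ ≤ ∫ x, |G x - s| ∂μ :=
    fun u => by
    refine (norm_integral_le_integral_norm _).trans_eq ?_
    simp_rw [norm_mul, norm_exp_mul_mul_I, mul_one, norm_real, Real.norm_eq_abs]
  have hb : ∀ u ∈ Metric.closedBall (0 : ℝ) |t|,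
      ‖-(u * E u * ∫ x, ((G x - s : ℝ) : ℂ) * exp (u * F x * I) ∂μ)‖ ≤
        |t| * Real.exp (t ^ 2 * s / 2) * ∫ x, |G x - s| ∂μ := fun u hu => by
    rw [mem_closedBall_zero_iff, Real.norm_eq_abs] at hu
    rw [norm_neg, norm_mul, norm_mul, nE, norm_real, Real.norm_eq_abs]
    have : u ^ 2 ≤ t ^ 2 := sq_le_sq.2 hu
    gcongr
    exact hδ u
  have hmv := (convex_closedBall (0 : ℝ) |t|).norm_image_sub_le_of_norm_hasDerivWithin_le
    (fun u _ => (dψ u).hasDerivWithinAt) hb (x := 0) (y := t) (by simp) (by simp)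
  have hψ0 : ψ 0 = 1 := by simp [hψ, hE]
  have hfac : ∫ x, exp (t * F x * I) ∂μ - exp (-(t ^ 2 * s / 2 : ℝ)) =
      (ψ t - ψ 0) * exp (-(t ^ 2 * s / 2 : ℝ)) := by
    rw [hψ0, sub_mul, one_mul, hψ]
    simp only [hE]
    rw [mul_assoc, ← exp_add, add_neg_cancel, exp_zero, mul_one]
  have hn : ‖exp (-(t ^ 2 * s / 2 : ℝ))‖ = Real.exp (-(t ^ 2 * s / 2)) := by
    rw [← ofReal_neg, ← ofReal_exp, norm_real, Real.norm_eq_abs, Real.abs_exp]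
  rw [hfac, norm_mul, hn]
  calc _ ≤ (|t| * Real.exp (t ^ 2 * s / 2) * (∫ x, |G x - s| ∂μ) * ‖t - 0‖) *
        Real.exp (-(t ^ 2 * s / 2)) := by gcongr
    _ = |t| ^ 2 * (∫ x, |G x - s| ∂μ) *
        (Real.exp (t ^ 2 * s / 2) * Real.exp (-(t ^ 2 * s / 2))) := by
        rw [sub_zero, Real.norm_eq_abs]
        ring
    _ = _ := by rw [← Real.exp_add, add_neg_cancel, Real.exp_zero, mul_one, sq_abs]

end CharFun

open Complex in
lemma IsUnitGaussian.norm_integral_exp_cubicHermite_sub_le {ι : Type*} [Fintype ι]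
    {μ : Measure (ι → ℝ)} {c : ι → ι → ℝ} (h : IsUnitGaussian μ c) (a : ℝ) {S : ℝ}
    (hS : ∀ j, ∑ k, |c j k| ≤ S) (hS0 : 0 ≤ S) {s : ℝ} (hs : 0 ≤ s) (t : ℝ) :
    ‖∫ x, exp (t * cubicHermite a x * I) ∂μ - exp (-(t ^ 2 * s / 2 : ℝ))‖ ≤
      t ^ 2 * (√(360 * hermiteMoment * a ^ 4 * Fintype.card ι * S ^ 3) +
        |6 * a ^ 2 * ∑ j, ∑ k, c j k ^ 3 - s|) := by
  have := h.isGaussian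
  have mG : HasMoments (steinKernel a c) μ := by fun_prop
  refine (norm_integral_exp_sub_le (HasMoments.integrable (by fun_prop)) mG.integrable
    (h.integral_cubicHermite_mul_exp a) hs t).trans ?_
  gcongr
  set m := ∫ y, steinKernel a c y ∂μ with hm
  have m1 : HasMoments (fun x => steinKernel a c x - m) μ := by fun_prop
  calc ∫ x, |steinKernel a c x - s| ∂μ ≤ ∫ x, (|steinKernel a c x - m| + |m - s|) ∂μ := by
        refine integral_mono (mG.integrable.sub (integrable_const s)).abs
          (m1.integrable.abs.add (integrable_const _)) fun x => abs_sub_le _ _ _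
    _ = ∫ x, |steinKernel a c x - m| ∂μ + |m - s| := by
        rw [integral_add m1.integrable.abs (integrable_const _)]
        simp
    _ ≤ _ := by
        rw [hm, h.integral_steinKernel, ← h.integral_steinKernel a, ← hm]
        gcongr
        exact (integral_abs_le_sqrt (m1 2 (by simp))).trans
          (Real.sqrt_le_sqrt (h.integral_steinKernel_sub_sq_le a hS hS0))

/-- The correlation function of the unit increments of a fractional Brownian motion with Hurst
parameter `1/6`. -/
def incrementCorr (r : ℝ) : ℝ :=
  (|r + 1| ^ ((1 : ℝ) / 3) + |r - 1| ^ ((1 : ℝ) / 3) - 2 * |r| ^ ((1 : ℝ) / 3)) / 2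

lemma incrementCorr_zero : incrementCorr 0 = 1 := by
  simp [incrementCorr]

lemma incrementCorr_neg (r : ℝ) : incrementCorr (-r) = incrementCorr r := by
  have h1 : |-r + 1| = |r - 1| := by rw [← abs_neg]; ring_nf
  have h2 : |-r - 1| = |r + 1| := by rw [← abs_neg]; ring_nf
  rw [incrementCorr, incrementCorr, h1, h2, abs_neg, add_comm (|r - 1| ^ _)]

lemma incrementCorr_natCast_succ (r : ℕ) :
    incrementCorr ((r : ℝ) + 1) =
      (((r : ℝ) + 2) ^ ((1 : ℝ) / 3) - ((r : ℝ) + 1) ^ ((1 : ℝ) / 3)) / 2 -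
      (((r : ℝ) + 1) ^ ((1 : ℝ) / 3) - (r : ℝ) ^ ((1 : ℝ) / 3)) / 2 := by
  rw [incrementCorr, abs_of_nonneg (by positivity), abs_of_nonneg (by simp),
    abs_of_nonneg (by positivity)]
  ring_nf

lemma incrementCorr_natCast_succ_nonpos (r : ℕ) : incrementCorr ((r : ℝ) + 1) ≤ 0 := by
  have hr : (r : ℝ) ∈ Set.Ici 0 := Set.mem_Ici.2 (by positivity)
  have hr2 : (r : ℝ) + 2 ∈ Set.Ici 0 := Set.mem_Ici.2 (by positivity)
  have h := (Real.concaveOn_rpow (p := (1 : ℝ) / 3) (by norm_num) (by norm_num)).2 hr hr2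
    (by norm_num : (0 : ℝ) ≤ 1 / 2) (by norm_num : (0 : ℝ) ≤ 1 / 2) (by norm_num)
  simp only [smul_eq_mul] at h
  rw [show (1 / 2 : ℝ) * r + 1 / 2 * (r + 2) = r + 1 by ring] at h
  rw [incrementCorr_natCast_succ]
  linarith

lemma sum_abs_incrementCorr_succ_le (m : ℕ) :
    ∑ r ∈ Finset.range m, |incrementCorr ((r : ℝ) + 1)| ≤ 1 / 2 := by
  have h : ∀ m : ℕ, ∑ r ∈ Finset.range m, |incrementCorr ((r : ℝ) + 1)| =
      (1 - (((m : ℝ) + 1) ^ ((1 : ℝ) / 3) - (m : ℝ) ^ ((1 : ℝ) / 3))) / 2 := fun m => by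
    induction m with
    | zero => simp
    | succ m ih =>
      rw [Finset.sum_range_succ, ih, abs_of_nonpos (incrementCorr_natCast_succ_nonpos m),
        incrementCorr_natCast_succ]
      push_cast
      ring_nf
  rw [h]
  have : (m : ℝ) ^ ((1 : ℝ) / 3) ≤ ((m : ℝ) + 1) ^ ((1 : ℝ) / 3) := by gcongr; simp
  linarith

lemma summable_abs_incrementCorr : Summable fun r : ℤ => |incrementCorr r| := by
  have h : Summable fun r : ℕ => |incrementCorr ((r : ℝ) + 1)| :=
    summable_of_sum_range_le (fun _ => abs_nonneg _) sum_abs_incrementCorr_succ_le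
  refine Summable.of_nat_of_neg_add_one ?_ ?_
  · refine (summable_nat_add_iff 1).1 ?_
    simpa using h
  · refine h.congr fun r => ?_
    push_cast
    rw [incrementCorr_neg]

lemma tsum_abs_incrementCorr_le : ∑' r : ℤ, |incrementCorr r| ≤ 2 := by
  have h : Summable fun r : ℕ => |incrementCorr ((r : ℝ) + 1)| :=
    summable_of_sum_range_le (fun _ => abs_nonneg _) sum_abs_incrementCorr_succ_le
  have h' : ∑' r : ℕ, |incrementCorr ((r : ℝ) + 1)| ≤ 1 / 2 :=
    Real.tsum_le_of_sum_range_le (fun _ => abs_nonneg _) sum_abs_incrementCorr_succ_le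
  have h0 : Summable fun r : ℕ => |incrementCorr ((r : ℤ) : ℝ)| := by
    refine (summable_nat_add_iff 1).1 ?_
    simpa using h
  have e1 : ∀ r : ℕ, |incrementCorr ((-((r : ℤ) + 1) : ℤ) : ℝ)| = |incrementCorr ((r : ℝ) + 1)| :=
    fun r => by push_cast; rw [incrementCorr_neg]
  have e2 : ∀ r : ℕ, |incrementCorr (((r + 1 : ℕ) : ℤ) : ℝ)| = |incrementCorr ((r : ℝ) + 1)| :=
    fun r => by push_cast; rfl
  have e0 : |incrementCorr (((0 : ℕ) : ℤ) : ℝ)| = 1 := by simp [incrementCorr_zero]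
  have key := tsum_of_nat_of_neg_add_one (f := fun r : ℤ => |incrementCorr r|) h0
    (h.congr fun r => (e1 r).symm)
  rw [h0.tsum_eq_zero_add, tsum_congr e1, tsum_congr e2, e0] at key
  rw [key]
  linarith

lemma sum_abs_incrementCorr_sub_le (m : ℕ) (j : Fin m) :
    ∑ k : Fin m, |incrementCorr ((j : ℝ) - (k : ℝ))| ≤ 2 := by
  have hinj : Function.Injective fun k : Fin m => (j : ℤ) - (k : ℤ) := fun k l hkl => by
    simpa [Fin.ext_iff] using hkl
  calc ∑ k : Fin m, |incrementCorr ((j : ℝ) - (k : ℝ))|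
      = ∑' k : Fin m, |incrementCorr (((j : ℤ) - (k : ℤ) : ℤ) : ℝ)| := by
        rw [tsum_fintype]
        push_cast
        rfl
    _ ≤ ∑' r : ℤ, |incrementCorr r| :=
        tsum_comp_le_tsum_of_inj summable_abs_incrementCorr (fun _ => abs_nonneg _) hinj
    _ ≤ 2 := tsum_abs_incrementCorr_le

lemma abs_incrementCorr_le_one (r : ℤ) : |incrementCorr r| ≤ 1 := by
  have h : ∀ n : ℕ, |incrementCorr ((n : ℝ))| ≤ 1 := fun n => by
    cases n with
    | zero => simp [incrementCorr_zero]
    | succ n =>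
      refine le_trans ?_ ((sum_abs_incrementCorr_succ_le (n + 1)).trans (by norm_num))
      rw [Finset.sum_range_succ]
      push_cast
      exact le_add_of_nonneg_left (Finset.sum_nonneg fun _ _ => abs_nonneg _)
  obtain ⟨n, rfl | rfl⟩ := r.eq_nat_or_neg
  · simpa using h n
  · simpa [incrementCorr_neg] using h n

lemma summable_incrementCorr_cube : Summable fun r : ℤ => incrementCorr r ^ 3 := by
  refine summable_abs_incrementCorr.of_norm_bounded fun r => ?_
  rw [norm_pow, Real.norm_eq_abs]
  exact pow_le_of_le_one (abs_nonneg _) (abs_incrementCorr_le_one r) (by norm_num)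

/-- Averages of a Toeplitz form converge to the sum of its symbol. -/
lemma tendsto_toeplitz_average {f : ℤ → ℝ} (hf : Summable f) :
    Tendsto (fun m : ℕ => (m : ℝ)⁻¹ * ∑ j : Fin m, ∑ k : Fin m, f ((j : ℤ) - (k : ℤ))) atTop
      (𝓝 (∑' r, f r)) := by
  set u : ℕ → ℝ := fun m => ∑ r ∈ Finset.range (m + 1), f r +
    ∑ r ∈ Finset.range m, f (-((r : ℤ) + 1)) with hu
  have h1 : Summable fun r : ℕ => f r := hf.comp_injective Nat.cast_injective
  have h2 : Summable fun r : ℕ => f (-((r : ℤ) + 1)) :=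
    hf.comp_injective fun a b hab => by simpa using hab
  have hlim : Tendsto u atTop (𝓝 (∑' r, f r)) := by
    rw [tsum_of_nat_of_neg_add_one h1 h2]
    exact (h1.hasSum.tendsto_sum_nat.comp (tendsto_add_atTop_nat 1)).add h2.hasSum.tendsto_sum_nat
  have hsum : ∀ m : ℕ, ∑ j : Fin m, ∑ k : Fin m, f ((j : ℤ) - (k : ℤ)) =
      ∑ i ∈ Finset.range m, u i := fun m => by
    induction m with
    | zero => simp
    | succ m ih =>
      rw [Finset.sum_range_succ, ← ih]
      simp_rw [Fin.sum_univ_castSucc, Finset.sum_add_distrib]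
      simp only [Fin.val_castSucc, Fin.val_last, sub_self, hu, Finset.sum_range_succ']
      have e1 : ∑ k : Fin m, f ((m : ℤ) - (k : ℤ)) =
          ∑ r ∈ Finset.range m, f ((r + 1 : ℕ) : ℤ) := by
        rw [Fin.sum_univ_eq_sum_range (fun k => f ((m : ℤ) - (k : ℤ))), ← Finset.sum_range_reflect]
        refine Finset.sum_congr rfl fun r hr => congrArg f ?_
        have := Finset.mem_range.1 hr
        omega
      have e2 : ∑ k : Fin m, f ((k : ℤ) - (m : ℤ)) =
          ∑ r ∈ Finset.range m, f (-((r : ℤ) + 1)) := by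
        rw [Fin.sum_univ_eq_sum_range (fun k => f ((k : ℤ) - (m : ℤ))), ← Finset.sum_range_reflect]
        refine Finset.sum_congr rfl fun r hr => congrArg f ?_
        have := Finset.mem_range.1 hr
        omega
      rw [e1, e2]
      simp only [Nat.cast_zero]
      ring
  simp_rw [hsum]
  exact hlim.cesaro

namespace IsFBM16

variable {Ω : Type*} [MeasureSpace Ω] {B : ℝ → Ω → ℝ}

lemma exists_map_eq_gaussianReal (hB : IsFBM16 B) {t : ℝ} (ht : 0 ≤ t) :
    ∃ v : NNReal, Measure.map (B t) (volume : Measure Ω) = gaussianReal 0 v := by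
  obtain ⟨v, hv⟩ := hB.2.2.1 1 (fun _ => t) (fun _ => 1) (fun _ => ht)
  exact ⟨v, by simpa using hv⟩

lemma memLp_two (hB : IsFBM16 B) {t : ℝ} (ht : 0 ≤ t) : MemLp (B t) 2 volume := by
  obtain ⟨v, hv⟩ := hB.exists_map_eq_gaussianReal ht
  have h : MemLp id 2 (Measure.map (B t) (volume : Measure Ω)) := by
    rw [hv]
    exact memLp_id_gaussianReal 2
  exact (memLp_map_measure_iff (by fun_prop) (hB.1 t).aemeasurable).1 h

lemma integral_eq_zero (hB : IsFBM16 B) {t : ℝ} (ht : 0 ≤ t) : ∫ ω, B t ω = 0 := by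
  obtain ⟨v, hv⟩ := hB.exists_map_eq_gaussianReal ht
  have h : ∫ x, x ∂(Measure.map (B t) (volume : Measure Ω)) = ∫ ω, B t ω :=
    integral_map (hB.1 t).aemeasurable (by fun_prop)
  rw [← h, hv, integral_id_gaussianReal]

lemma integral_increment_mul (hB : IsFBM16 B) {s s' t t' : ℝ} (hs : 0 ≤ s) (hs' : 0 ≤ s')
    (ht : 0 ≤ t) (ht' : 0 ≤ t') :
    ∫ ω, (B s' ω - B s ω) * (B t' ω - B t ω) =
      (|t - s'| ^ ((1 : ℝ) / 3) + |t' - s| ^ ((1 : ℝ) / 3) - |t' - s'| ^ ((1 : ℝ) / 3)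
        - |t - s| ^ ((1 : ℝ) / 3)) / 2 := by
  have hi : ∀ {u v : ℝ}, 0 ≤ u → 0 ≤ v → Integrable (fun ω => B u ω * B v ω) volume :=
    fun hu hv => (hB.memLp_two hu).integrable_mul (hB.memLp_two hv)
  have hd : ∀ {u}, 0 ≤ u → Integrable (fun ω => B u ω * B t' ω - B u ω * B t ω) volume :=
    fun hu => (hi hu ht').sub (hi hu ht)
  simp_rw [sub_mul, mul_sub]
  rw [integral_sub (hd hs') (hd hs),
    integral_sub (hi hs' ht') (hi hs' ht), integral_sub (hi hs ht') (hi hs ht),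
    hB.2.2.2 _ _ hs' ht', hB.2.2.2 _ _ hs' ht, hB.2.2.2 _ _ hs ht', hB.2.2.2 _ _ hs ht]
  ring

variable [IsProbabilityMeasure (volume : Measure Ω)]

/-- The normalized increments on the grid of mesh `1 / n`. -/
lemma isUnitGaussian_map_increments (hB : IsFBM16 B) {n : ℕ} (hn : 0 < n) {q : ℝ}
    (hq : q ^ 2 = (n : ℝ) ^ ((1 : ℝ) / 3)) (m : ℕ) :
    IsUnitGaussian (Measure.map (fun ω (j : Fin m) =>
        q * (B (((j : ℝ) + 1) / n) ω - B ((j : ℝ) / n) ω)) (volume : Measure Ω))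
      (fun j k => incrementCorr ((j : ℝ) - (k : ℝ))) := by
  have hmeas : ∀ t, Measurable (B t) := hB.1
  have hX : Measurable (fun ω (j : Fin m) =>
      q * (B (((j : ℝ) + 1) / n) ω - B ((j : ℝ) / n) ω)) :=
    measurable_pi_lambda _ fun j => ((hmeas _).sub (hmeas _)).const_mul q
  have hL2 : ∀ {t : ℝ}, 0 ≤ t → Integrable (B t) volume := fun ht =>
    (hB.memLp_two ht).integrable (by norm_num)
  refine ⟨?_, fun k => ?_, fun j k => ?_, fun j => by simp [incrementCorr_zero]⟩
  · refine isGaussian_of_map_eq_gaussianReal fun L => ?_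
    obtain ⟨v, hv⟩ := hB.2.2.1 (m + m)
      (Fin.append (fun j : Fin m => ((j : ℝ) + 1) / n) (fun j : Fin m => (j : ℝ) / n))
      (Fin.append (fun j : Fin m => L (Pi.single j 1) * q)
        (fun j : Fin m => -(L (Pi.single j 1) * q)))
      (fun i => by
        refine Fin.addCases (fun j => ?_) (fun j => ?_) i
        · rw [Fin.append_left]; positivity
        · rw [Fin.append_right]; positivity)
    refine ⟨0, v, ?_⟩
    rw [← hv, Measure.map_map (by fun_prop) hX]
    congr 1
    ext ω
    rw [Function.comp_apply, ← ContinuousLinearMap.coe_coe, LinearMap.pi_apply_eq_sum_univ]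
    simp only [Fin.sum_univ_add, Fin.append_left, Fin.append_right, ← Finset.sum_add_distrib]
    refine Finset.sum_congr rfl fun j _ => ?_
    have : (fun i => if j = i then (1 : ℝ) else 0) = Pi.single j 1 := by
      ext i
      simp [Pi.single_apply, eq_comm]
    rw [this, ContinuousLinearMap.coe_coe, smul_eq_mul]
    ring
  · rw [integral_map hX.aemeasurable (measurable_pi_apply k).aestronglyMeasurable,
      integral_const_mul,
      integral_sub (hL2 (by positivity)) (hL2 (by positivity)), hB.integral_eq_zero (by positivity),
      hB.integral_eq_zero (by positivity)]
    simp
  · rw [integral_map hX.aemeasurable (by fun_prop)]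
    have hmul : ∀ ω, q * (B (((j : ℝ) + 1) / n) ω - B ((j : ℝ) / n) ω) *
        (q * (B (((k : ℝ) + 1) / n) ω - B ((k : ℝ) / n) ω)) =
        q ^ 2 * ((B (((j : ℝ) + 1) / n) ω - B ((j : ℝ) / n) ω) *
          (B (((k : ℝ) + 1) / n) ω - B ((k : ℝ) / n) ω)) := fun ω => by ring
    simp_rw [hmul]
    rw [integral_const_mul, hB.integral_increment_mul (by positivity) (by positivity)
      (by positivity) (by positivity), hq]
    have hn' : (0 : ℝ) < n := Nat.cast_pos.2 hn
    have hdiv : ∀ x y : ℝ, |x / n - y / n| ^ ((1 : ℝ) / 3) =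
        |y - x| ^ ((1 : ℝ) / 3) / (n : ℝ) ^ ((1 : ℝ) / 3) := fun x y => by
      rw [← sub_div, abs_div, abs_of_pos hn', Real.div_rpow (abs_nonneg _) hn'.le, abs_sub_comm]
    have hpos : (0 : ℝ) < (n : ℝ) ^ ((1 : ℝ) / 3) := by positivity
    simp_rw [hdiv, incrementCorr]
    rw [show (j : ℝ) + 1 - k = j - k + 1 by ring, show (j : ℝ) - (k + 1) = j - k - 1 by ring,
      show (j : ℝ) + 1 - (k + 1) = j - k by ring]
    field_simp
    ring

lemma integral_abs_sub_zero_le (hB : IsFBM16 B) {t : ℝ} (ht : 0 ≤ t) :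
    ∫ ω, |B t ω - B 0 ω| ≤ √(t ^ ((1 : ℝ) / 3)) := by
  refine (integral_abs_le_sqrt ((hB.memLp_two ht).sub (hB.memLp_two le_rfl))).trans_eq ?_
  simp only [Pi.sub_apply, pow_two]
  rw [hB.integral_increment_mul le_rfl ht le_rfl ht]
  simp [abs_of_nonneg ht]

end IsFBM16

open Complex in
lemma norm_exp_mul_I_sub_exp_mul_I_le (u x y : ℝ) :
    ‖exp (u * x * I) - exp (u * y * I)‖ ≤ |u| * |x - y| := by
  have h : exp (u * x * I) - exp (u * y * I) =
      exp (u * y * I) * (exp (I * (u * (x - y) : ℝ)) - 1) := by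
    rw [mul_sub, ← exp_add, mul_one]
    congr 2
    push_cast
    ring
  rw [h, norm_mul, norm_exp_mul_mul_I, one_mul]
  refine Real.norm_exp_I_mul_ofReal_sub_one_le.trans_eq ?_
  rw [Real.norm_eq_abs, abs_mul]

open Complex in
/-- Quantitative comparison of the characteristic function of the cubic variation with that of a
centered Gaussian law. -/
lemma IsFBM16.norm_integral_exp_sub_le {Ω : Type*} [MeasureSpace Ω]
    [IsProbabilityMeasure (volume : Measure Ω)] {B : ℝ → Ω → ℝ} (hB : IsFBM16 B) {n m : ℕ}
    (hn : 0 < n) {t : ℝ} (hm : (m : ℝ) ≤ n * t) {s : ℝ} (hs : 0 ≤ s) (u : ℝ) :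
    ‖(∫ ω, exp (u * (∑ j : Fin m, (B (((j : ℝ) + 1) / n) ω - B ((j : ℝ) / n) ω) ^ 3 : ℝ) * I)) -
        exp (-(u ^ 2 * s / 2 : ℝ))‖ ≤
      |u| * (3 * ((n : ℝ) ^ ((1 : ℝ) / 3))⁻¹ * √(t ^ ((1 : ℝ) / 3))) +
      u ^ 2 * (√(2880 * hermiteMoment * t * (n : ℝ)⁻¹) +
        |6 * (n : ℝ)⁻¹ * ∑ j : Fin m, ∑ k : Fin m, incrementCorr ((j : ℝ) - (k : ℝ)) ^ 3 - s|) := by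
  have hn' : (0 : ℝ) < n := Nat.cast_pos.2 hn
  set q : ℝ := (n : ℝ) ^ ((1 : ℝ) / 6) with hq
  have hq0 : 0 < q := by positivity
  have hq2 : q ^ 2 = (n : ℝ) ^ ((1 : ℝ) / 3) := by
    rw [hq, ← Real.rpow_natCast, ← Real.rpow_mul hn'.le]
    norm_num
  have hq6 : q ^ 6 = n := by
    rw [hq, ← Real.rpow_natCast, ← Real.rpow_mul hn'.le]
    norm_num
  set X : Ω → Fin m → ℝ := fun ω j => q * (B (((j : ℝ) + 1) / n) ω - B ((j : ℝ) / n) ω) with hX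
  have mX : Measurable X :=
    measurable_pi_lambda _ fun j => ((hB.1 _).sub (hB.1 _)).const_mul q
  have hG := hB.isUnitGaussian_map_increments hn hq2 m
  have hprob : IsProbabilityMeasure (Measure.map X (volume : Measure Ω)) :=
    Measure.isProbabilityMeasure_map mX.aemeasurable
  have hdecomp : ∀ ω, ∑ j : Fin m, (B (((j : ℝ) + 1) / n) ω - B ((j : ℝ) / n) ω) ^ 3 -
      cubicHermite (q ^ 3)⁻¹ (X ω) = 3 * (q ^ 2)⁻¹ * (B (m / n) ω - B 0 ω) := fun ω => by
    have htel : B (m / n) ω - B 0 ω =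
        ∑ j : Fin m, (B (((j : ℝ) + 1) / n) ω - B ((j : ℝ) / n) ω) := by
      rw [Fin.sum_univ_eq_sum_range
        (fun j : ℕ => B (((j : ℝ) + 1) / n) ω - B ((j : ℝ) / n) ω)]
      have := Finset.sum_range_sub (fun j : ℕ => B ((j : ℝ) / n) ω) m
      push_cast at this
      rw [this, zero_div]
    rw [htel, cubicHermite, Finset.mul_sum, Finset.mul_sum, ← Finset.sum_sub_distrib]
    refine Finset.sum_congr rfl fun j _ => ?_
    simp only [hX]
    field_simp
    ring
  have hmt : (m : ℝ) / n ≤ t := by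
    rw [div_le_iff₀ hn']
    linarith
  have cH : Continuous fun x : Fin m → ℝ => exp (u * cubicHermite (q ^ 3)⁻¹ x * I) := by fun_prop
  have hmap : ∫ x, exp (u * cubicHermite (q ^ 3)⁻¹ x * I) ∂(Measure.map X volume) =
      ∫ ω, exp (u * cubicHermite (q ^ 3)⁻¹ (X ω) * I) :=
    integral_map mX.aemeasurable cH.aestronglyMeasurable
  have h1 : ‖(∫ ω,
        exp (u * (∑ j : Fin m, (B (((j : ℝ) + 1) / n) ω - B ((j : ℝ) / n) ω) ^ 3 : ℝ) * I)) -
      ∫ ω, exp (u * cubicHermite (q ^ 3)⁻¹ (X ω) * I)‖ ≤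
      |u| * (3 * ((n : ℝ) ^ ((1 : ℝ) / 3))⁻¹ * √(t ^ ((1 : ℝ) / 3))) := by
    have mV : Measurable fun ω =>
        ∑ j : Fin m, (B (((j : ℝ) + 1) / n) ω - B ((j : ℝ) / n) ω) ^ 3 :=
      Finset.measurable_sum _ fun j _ => ((hB.1 _).sub (hB.1 _)).pow_const 3
    have mF : Measurable fun ω => cubicHermite (q ^ 3)⁻¹ (X ω) :=
      (by fun_prop : Continuous fun x : Fin m → ℝ => cubicHermite (q ^ 3)⁻¹ x).measurable.comp mX
    have hint : ∀ {f : Ω → ℝ}, Measurable f → Integrable (fun ω => exp (u * f ω * I)) volume :=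
      fun hf => .of_bound (aestronglyMeasurable_exp_mul_I hf.aestronglyMeasurable u) 1
        (ae_of_all _ fun ω => (norm_exp_mul_mul_I u _).le)
    have hi0 : Integrable (fun ω => |B (m / n) ω - B 0 ω|) volume :=
      (((hB.memLp_two (by positivity)).sub (hB.memLp_two le_rfl)).integrable (by norm_num)).abs
    rw [← integral_sub (hint mV) (hint mF)]
    calc _ ≤ ∫ ω, |u| * (3 * (q ^ 2)⁻¹ * |B (m / n) ω - B 0 ω|) := by
          refine norm_integral_le_of_norm_le ((hi0.const_mul _).const_mul _)
            (ae_of_all _ fun ω => (norm_exp_mul_I_sub_exp_mul_I_le _ _ _).trans_eq ?_)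
          rw [hdecomp, abs_mul, abs_of_pos (by positivity : 0 < 3 * (q ^ 2)⁻¹)]
      _ = |u| * (3 * (q ^ 2)⁻¹ * ∫ ω, |B (m / n) ω - B 0 ω|) := by
          rw [integral_const_mul, integral_const_mul]
      _ ≤ _ := by
          rw [hq2]
          gcongr
          refine (hB.integral_abs_sub_zero_le (by positivity)).trans ?_
          gcongr
  have h2 := hG.norm_integral_exp_cubicHermite_sub_le (q ^ 3)⁻¹
    (sum_abs_incrementCorr_sub_le m) (by norm_num) hs u
  rw [hmap] at h2
  refine (norm_sub_le_norm_sub_add_norm_sub _ _ _).trans (add_le_add h1 (h2.trans ?_))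
  have ha2 : ((q ^ 3)⁻¹) ^ 2 = (n : ℝ)⁻¹ := by
    rw [inv_pow, ← pow_mul, hq6]
  have ha4 : ((q ^ 3)⁻¹) ^ 4 = (n : ℝ)⁻¹ * (n : ℝ)⁻¹ := by
    rw [← ha2]
    ring
  rw [ha2, ha4, Fintype.card_fin]
  have := hermiteMoment_nonneg
  gcongr u ^ 2 * (√?_ + _)
  calc 360 * hermiteMoment * ((n : ℝ)⁻¹ * (n : ℝ)⁻¹) * m * 2 ^ 3
      = 2880 * hermiteMoment * (m / n) * (n : ℝ)⁻¹ := by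
        ring
    _ ≤ 2880 * hermiteMoment * t * (n : ℝ)⁻¹ := by gcongr

lemma sum_Icc_one_eq_sum_fin (f : ℕ → ℝ) (m : ℕ) :
    ∑ j ∈ Finset.Icc 1 m, f j = ∑ j : Fin m, f (j + 1) := by
  rw [Fin.sum_univ_eq_sum_range (fun j => f (j + 1)), Finset.range_eq_Ico,
    Finset.sum_Ico_add' f 0 m 1]
  rfl

lemma tsum_kappaTerm : ∑' r : ℤ, kappaTerm r = 8 * ∑' r : ℤ, incrementCorr r ^ 3 := by
  rw [← tsum_mul_left]
  refine tsum_congr fun r => ?_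
  rw [kappaTerm, incrementCorr]
  ring

/-- For every `t > 0`, `V_n(t) = ∑_{j=1}^{⌊nt⌋} (B(j/n) - B((j-1)/n))³` converges in
distribution to a centered Gaussian with variance `κ² t`. -/
theorem stmt10 {Ω : Type*} [MeasureSpace Ω] [IsProbabilityMeasure (volume : Measure Ω)]
    (B : ℝ → Ω → ℝ) (hB : IsFBM16 B)
    (κ : ℝ) (hκ : 0 < κ) (hκ2 : κ ^ 2 = (3 / 4) * ∑' r : ℤ, kappaTerm r)
    (t : ℝ) (ht : 0 < t) :
    ∀ F : BoundedContinuousFunction ℝ ℝ,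
      Tendsto (fun n : ℕ =>
          ∫ ω, F (∑ j ∈ Finset.Icc 1 ⌊(n : ℝ) * t⌋₊,
            (B ((j : ℝ) / n) ω - B (((j : ℝ) - 1) / n) ω) ^ 3))
        atTop
        (𝓝 (∫ x, F x ∂(gaussianReal 0 (Real.toNNReal (κ ^ 2 * t))))) := by
  intro F
  set V : ℕ → Ω → ℝ := fun n ω => ∑ j : Fin ⌊(n : ℝ) * t⌋₊,
    (B (((j : ℝ) + 1) / n) ω - B ((j : ℝ) / n) ω) ^ 3 with hV
  have mV : ∀ n, Measurable (V n) := fun n =>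
    Finset.measurable_sum _ fun j _ => ((hB.1 _).sub (hB.1 _)).pow_const 3
  have hsum : ∀ (n : ℕ) (ω : Ω), ∑ j ∈ Finset.Icc 1 ⌊(n : ℝ) * t⌋₊,
      (B ((j : ℝ) / n) ω - B (((j : ℝ) - 1) / n) ω) ^ 3 = V n ω := fun n ω => by
    rw [sum_Icc_one_eq_sum_fin
      fun j : ℕ => (B ((j : ℝ) / n) ω - B (((j : ℝ) - 1) / n) ω) ^ 3]
    simp [hV]
  simp_rw [hsum]
  let P : ℕ → ProbabilityMeasure ℝ := fun n =>
    ⟨Measure.map (V n) volume, Measure.isProbabilityMeasure_map (mV n).aemeasurable⟩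
  let Q : ProbabilityMeasure ℝ := ⟨gaussianReal 0 (Real.toNNReal (κ ^ 2 * t)), inferInstance⟩
  suffices h : Tendsto P atTop (𝓝 Q) by
    refine (ProbabilityMeasure.tendsto_iff_forall_integral_tendsto.1 h F).congr fun n => ?_
    exact integral_map (mV n).aemeasurable F.continuous.aestronglyMeasurable
  refine ProbabilityMeasure.tendsto_iff_tendsto_charFun.2 fun u => ?_
  have hs : 0 ≤ κ ^ 2 * t := by positivity
  have hQ : charFun (Q : Measure ℝ) u = Complex.exp (-(u ^ 2 * (κ ^ 2 * t) / 2 : ℝ)) := by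
    refine (charFun_gaussianReal u).trans ?_
    rw [Real.coe_toNNReal _ hs]
    congr 1
    push_cast
    ring
  have hP : ∀ n, charFun (P n : Measure ℝ) u =
      ∫ ω, Complex.exp (u * (V n ω : ℝ) * Complex.I) := fun n => by
    rw [charFun_apply_real]
    exact integral_map (mV n).aemeasurable
      (by fun_prop : Continuous fun x : ℝ => Complex.exp (u * x * Complex.I)).aestronglyMeasurable
  simp_rw [hQ, hP]
  have hfloor : Tendsto (fun n : ℕ => (⌊(n : ℝ) * t⌋₊ : ℝ) * (n : ℝ)⁻¹) atTop (𝓝 t) := by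
    refine ((tendsto_nat_floor_mul_div_atTop ht.le).comp
      (tendsto_natCast_atTop_atTop (R := ℝ))).congr fun n => ?_
    simp [mul_comm t, div_eq_mul_inv]
  have hfloor_top : Tendsto (fun n : ℕ => ⌊(n : ℝ) * t⌋₊) atTop atTop := by
    simpa only [mul_comm t] using tendsto_nat_floor_mul_atTop t ht
  have hmean : Tendsto (fun n : ℕ => 6 * (n : ℝ)⁻¹ * ∑ j : Fin ⌊(n : ℝ) * t⌋₊,
      ∑ k : Fin ⌊(n : ℝ) * t⌋₊, incrementCorr ((j : ℝ) - (k : ℝ)) ^ 3) atTop (𝓝 (κ ^ 2 * t)) := by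
    have h1 := ((tendsto_toeplitz_average summable_incrementCorr_cube).comp hfloor_top).mul hfloor
    have h2 := h1.const_mul 6
    rw [show 6 * ((∑' r : ℤ, incrementCorr r ^ 3) * t) = κ ^ 2 * t by
      rw [hκ2, tsum_kappaTerm]; ring] at h2
    refine h2.congr' ?_
    filter_upwards [hfloor_top.eventually_gt_atTop 0] with n hn
    have hn' : (⌊(n : ℝ) * t⌋₊ : ℝ) ≠ 0 := by exact_mod_cast hn.ne'
    simp only [Function.comp_apply]
    push_cast
    field_simp
  have hinv : Tendsto (fun n : ℕ => (n : ℝ)⁻¹) atTop (𝓝 0) := tendsto_inv_atTop_nhds_zero_nat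
  have hroot : Tendsto (fun n : ℕ => ((n : ℝ) ^ ((1 : ℝ) / 3))⁻¹) atTop (𝓝 0) :=
    ((tendsto_rpow_atTop (by norm_num)).comp tendsto_natCast_atTop_atTop).inv_tendsto_atTop
  have hbound : Tendsto (fun n : ℕ =>
      |u| * (3 * ((n : ℝ) ^ ((1 : ℝ) / 3))⁻¹ * √(t ^ ((1 : ℝ) / 3))) +
      u ^ 2 * (√(2880 * hermiteMoment * t * (n : ℝ)⁻¹) +
        |6 * (n : ℝ)⁻¹ * ∑ j : Fin ⌊(n : ℝ) * t⌋₊, ∑ k : Fin ⌊(n : ℝ) * t⌋₊,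
          incrementCorr ((j : ℝ) - (k : ℝ)) ^ 3 - κ ^ 2 * t|)) atTop (𝓝 0) := by
    have h1 := (((hroot.const_mul 3).mul_const (√(t ^ ((1 : ℝ) / 3)))).const_mul |u|)
    have h2 := ((hinv.const_mul (2880 * hermiteMoment * t)).sqrt.add
      (hmean.sub_const (κ ^ 2 * t)).abs).const_mul (u ^ 2)
    simpa using h1.add h2
  rw [tendsto_iff_norm_sub_tendsto_zero]
  refine squeeze_zero' (.of_forall fun n => norm_nonneg _) ?_ hbound
  filter_upwards [eventually_gt_atTop 0] with n hn
  exact hB.norm_integral_exp_sub_le hn (Nat.floor_le (by positivity)) hs u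
end
end

section
/- Let f, g : ℝ → ℝ be infinitely differentiable. Then there exists an infinitely differentiable function h₅ : ℝ → ℝ such that for every K > 0 there is a finite constant C_K with the following property: for all a, b ∈ [−K, K], writing x = (a+b)/2, | ((f(a)+f(b))/2)(g(b)−g(a)) − (f g')(x)(b−a) − ( (1/8) f'' g' + (1/24) f g''' )(x)(b−a)³ − h₅(x)(b−a)⁵ | ≤ C_K |b−a|⁷. -/
noncomputable section

lemma ContDiff.iteratedDeriv_of_infty {f : ℝ → ℝ} (hf : ContDiff ℝ (⊤ : ℕ∞) f) (n : ℕ) :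
    ContDiff ℝ (⊤ : ℕ∞) (iteratedDeriv n f) := by
  rw [iteratedDeriv_eq_iterate]
  exact hf.iterate_deriv n

/-- Taylor's theorem for a smooth function, with a remainder bound uniform in the base point
on a compact interval. -/
lemma exists_uniform_taylor_bound {f : ℝ → ℝ} (hf : ContDiff ℝ (⊤ : ℕ∞) f) (n : ℕ) (K : ℝ) :
    ∃ C : ℝ, ∀ x ∈ Set.Icc (-K) K, ∀ y ∈ Set.Icc (-K) K,
      |f y - ∑ k ∈ Finset.range (n + 1),
          ((k.factorial : ℝ)⁻¹ * (y - x) ^ k) * iteratedDeriv k f x| ≤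
        C * |y - x| ^ (n + 1) := by
  obtain ⟨C, hC⟩ := (isCompact_Icc (a := -K) (b := K)).exists_bound_of_continuousOn
    (hf.iteratedDeriv_of_infty (n + 1)).continuous.continuousOn
  refine ⟨C / (n + 1).factorial, fun x hx y hy => ?_⟩
  rcases eq_or_ne x y with rfl | hxy
  · simp [Finset.sum_range_succ']
  obtain ⟨z, hz, h⟩ := taylor_mean_remainder_lagrange_iteratedDeriv (n := n) hxy
    (hf.contDiffOn.of_le (by exact_mod_cast le_top))
  have hsum : taylorWithinEval f n (Set.uIcc x y) x y = ∑ k ∈ Finset.range (n + 1),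
      ((k.factorial : ℝ)⁻¹ * (y - x) ^ k) * iteratedDeriv k f x := by
    rw [taylor_within_apply]
    refine Finset.sum_congr rfl fun k _ => ?_
    rw [iteratedDerivWithin_eq_iteratedDeriv (uniqueDiffOn_uIcc hxy)
      (hf.contDiffAt.of_le (by exact_mod_cast le_top)) Set.left_mem_uIcc, smul_eq_mul]
  rw [← hsum, h, abs_div, abs_mul, abs_pow, Nat.abs_cast, div_mul_eq_mul_div]
  have hzK := hC z (Set.uIcc_subset_Icc hx hy (Set.uIoo_subset_uIcc_self hz))
  rw [Real.norm_eq_abs] at hzK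
  gcongr

lemma exists_abs_le_of_continuous_uncurry {φ : ℝ → ℝ → ℝ} (hφ : Continuous (Function.uncurry φ))
    (K : ℝ) : ∃ C : ℝ, ∀ x ∈ Set.Icc (-K) K, ∀ y ∈ Set.Icc (-K) K, |φ x y| ≤ C := by
  obtain ⟨C, hC⟩ := ((isCompact_Icc (a := -K) (b := K)).prod
    (isCompact_Icc (a := -K) (b := K))).exists_bound_of_continuousOn hφ.continuousOn
  exact ⟨C, fun x hx y hy => hC (x, y) ⟨hx, hy⟩⟩

/-- Expansion of the symmetric Riemann-sum increment `((f(a)+f(b))/2)(g(b)-g(a))` about the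
midpoint `x = (a+b)/2`: there is a smooth `h₅` such that on every `[-K,K]` the remainder
after the terms of order `(b-a)`, `(b-a)³`, `(b-a)⁵` is bounded by `C_K |b-a|⁷`. -/
theorem stmt14 (f g : ℝ → ℝ) (hf : ContDiff ℝ (⊤ : ℕ∞) f) (hg : ContDiff ℝ (⊤ : ℕ∞) g) :
    ∃ h₅ : ℝ → ℝ, ContDiff ℝ (⊤ : ℕ∞) h₅ ∧
      ∀ K > (0 : ℝ), ∃ C : ℝ,
        ∀ a ∈ Set.Icc (-K) K, ∀ b ∈ Set.Icc (-K) K,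
          |((f a + f b) / 2) * (g b - g a)
              - f ((a + b) / 2) * deriv g ((a + b) / 2) * (b - a)
              - ((1 / 8) * iteratedDeriv 2 f ((a + b) / 2) * deriv g ((a + b) / 2)
                  + (1 / 24) * f ((a + b) / 2) * iteratedDeriv 3 g ((a + b) / 2)) *
                  (b - a) ^ 3
              - h₅ ((a + b) / 2) * (b - a) ^ 5|
            ≤ C * |b - a| ^ 7 := by
  refine ⟨fun x => f x * iteratedDeriv 5 g x / 1920
      + iteratedDeriv 2 f x * iteratedDeriv 3 g x / 192
      + iteratedDeriv 4 f x * iteratedDeriv 1 g x / 384, ?_, fun K _ => ?_⟩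
  · have := hf.iteratedDeriv_of_infty
    have := hg.iteratedDeriv_of_infty
    fun_prop
  have cf := fun n => (hf.iteratedDeriv_of_infty n).continuous
  have cg := fun n => (hg.iteratedDeriv_of_infty n).continuous
  obtain ⟨R, hR⟩ := exists_uniform_taylor_bound hf 5 K
  obtain ⟨S, hS⟩ := exists_uniform_taylor_bound hg 6 K
  obtain ⟨M, hM⟩ := exists_abs_le_of_continuous_uncurry (φ := fun a b => (f a + f b) / 2)
    (by have := hf.continuous; fun_prop) K
  obtain ⟨Q, hQ⟩ := exists_abs_le_of_continuous_uncurry (φ := fun x t =>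
    2 * (iteratedDeriv 1 g x + iteratedDeriv 3 g x * t ^ 2 / 6 + iteratedDeriv 5 g x * t ^ 4 / 120))
    (by have := cg 1; have := cg 3; have := cg 5; fun_prop) K
  obtain ⟨W, hW⟩ := exists_abs_le_of_continuous_uncurry (φ := fun x t =>
    2 * (iteratedDeriv 2 f x * iteratedDeriv 5 g x / 240
      + iteratedDeriv 4 f x * iteratedDeriv 3 g x / 144
      + iteratedDeriv 4 f x * iteratedDeriv 5 g x / 2880 * t ^ 2))
    (by have := cf 2; have := cf 4; have := cg 3; have := cg 5; fun_prop) K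
  refine ⟨(M * (2 * S) + R * Q + W) / 128, fun a ha b hb => ?_⟩
  obtain ⟨x, t, rfl, rfl⟩ : ∃ x t : ℝ, a = x - t ∧ b = x + t :=
    ⟨(a + b) / 2, (b - a) / 2, by ring, by ring⟩
  have hx : x ∈ Set.Icc (-K) K := ⟨by linarith [ha.1, hb.1], by linarith [ha.2, hb.2]⟩
  have ht : t ∈ Set.Icc (-K) K := ⟨by linarith [ha.2, hb.1], by linarith [ha.1, hb.2]⟩
  have hRa := hR x hx _ ha
  have hRb := hR x hx _ hb
  have hSa := hS x hx _ ha
  have hSb := hS x hx _ hb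
  have hM := hM _ ha _ hb
  have hQ := hQ x hx t ht
  have hW := hW x hx t ht
  simp only [Finset.sum_range_succ, Finset.sum_range_zero, Nat.factorial, iteratedDeriv_zero,
    sub_sub_cancel_left, add_sub_cancel_left, abs_neg] at hRa hRb hSa hSb
  have e1 : (x - t + (x + t)) / 2 = x := by ring
  have e2 : x + t - (x - t) = 2 * t := by ring
  rw [e1, e2, ← iteratedDeriv_one]
  beta_reduce
  set F := (f (x - t) + f (x + t)) / 2 with hF
  set q := 2 * (iteratedDeriv 1 g x + iteratedDeriv 3 g x * t ^ 2 / 6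
    + iteratedDeriv 5 g x * t ^ 4 / 120) with hq
  set w := 2 * (iteratedDeriv 2 f x * iteratedDeriv 5 g x / 240
      + iteratedDeriv 4 f x * iteratedDeriv 3 g x / 144
      + iteratedDeriv 4 f x * iteratedDeriv 5 g x / 2880 * t ^ 2) with hw
  set r := F - (f x + iteratedDeriv 2 f x * t ^ 2 / 2 + iteratedDeriv 4 f x * t ^ 4 / 24) with hr
  set s := g (x + t) - g (x - t) - t * q with hs
  have hr' : |r| ≤ R * |t| ^ 6 := by
    rw [abs_le] at hRa hRb ⊢
    norm_num at hRa hRb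
    constructor <;> rw [hr, hF] <;> linarith [hRa.1, hRb.1, hRa.2, hRb.2]
  have hs' : |s| ≤ 2 * S * |t| ^ 7 := by
    rw [abs_le] at hSa hSb ⊢
    norm_num at hSa hSb
    constructor <;> rw [hs, hq, iteratedDeriv_one] <;> linarith [hSa.1, hSb.1, hSa.2, hSb.2]
  calc _ = |F * s + r * q * t + w * t ^ 7| := by
        congr 1
        rw [hs, hr, hw, hq]
        ring
    _ ≤ |F| * |s| + |r| * |q| * |t| + |w| * |t| ^ 7 := by
        simp only [← abs_mul, ← abs_pow]
        exact abs_add_three _ _ _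
    _ ≤ M * (2 * S * |t| ^ 7) + (R * |t| ^ 6) * Q * |t| + W * |t| ^ 7 := by
        have := (abs_nonneg F).trans hM
        have := (abs_nonneg r).trans hr'
        gcongr
    _ = _ := by
        rw [abs_mul, abs_two]
        ring
end
end
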